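/- Let k ≥ 1 be an integer and α = 2(k − 1). Suppose v : ℝ² → ℝ is a C² function satisfying Δv(x) + 2(α+2)²·(|x|^α/(1 + |x|^{2+α})²)·v(x) = 0 for all x ∈ ℝ² and ∫_{ℝ²} |∇v(x)|² dx < ∞. Then there exist constants c₀, c₁, c₂ ∈ ℝ such that, writing x = (x₁, x₂) and z = x₁ + i x₂, v(x) = c₀·(1 − |x|^{2+α})/(1 + |x|^{2+α}) + ( c₁·Re(z^k) + c₂·Im(z^k) )/(1 + |x|^{2+α}) for all x ∈ ℝ². Conversely, every function of this form is a C² finite-Dirichlet-energy solution. -/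

import Mathlib

open Set MeasureTheory

noncomputable section

/-- The Euclidean Laplacian on `ℝ²`: the sum of the two second partial derivatives. -/
def planeLaplacian (u : EuclideanSpace ℝ (Fin 2) → ℝ) (x : EuclideanSpace ℝ (Fin 2)) : ℝ :=
  ∑ i : Fin 2,
    deriv (deriv (fun t : ℝ => u (x + t • EuclideanSpace.single i (1 : ℝ)))) 0

/-- The explicit three-parameter family of solutions of the linearized equation when
`α = 2(k−1)`: in complex notation `z = x₁ + i x₂`,
`c₀ (1−|x|^{2+α})/(1+|x|^{2+α}) + (c₁ Re z^k + c₂ Im z^k)/(1+|x|^{2+α})`. -/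
def linSol (α : ℝ) (k : ℕ) (c₀ c₁ c₂ : ℝ) (x : EuclideanSpace ℝ (Fin 2)) : ℝ :=
  c₀ * (1 - ‖x‖ ^ (2 + α)) / (1 + ‖x‖ ^ (2 + α)) +
    (c₁ * ((((x 0 : ℝ) : ℂ) + ((x 1 : ℝ) : ℂ) * Complex.I) ^ k).re +
     c₂ * ((((x 0 : ℝ) : ℂ) + ((x 1 : ℝ) : ℂ) * Complex.I) ^ k).im) /
      (1 + ‖x‖ ^ (2 + α))

/-- complex coordinate -/
def zc (x : EuclideanSpace ℝ (Fin 2)) : ℂ := ((x 0 : ℝ) : ℂ) + ((x 1 : ℝ) : ℂ) * Complex.I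

lemma zc_norm (x : EuclideanSpace ℝ (Fin 2)) : ‖zc x‖ = ‖x‖ := by
  rw [EuclideanSpace.norm_eq, zc, Complex.norm_add_mul_I]
  simp [Fin.sum_univ_two]

lemma norm_pow_alpha (k : ℕ) (hk : 1 ≤ k) (α : ℝ) (hα : α = 2 * ((k : ℝ) - 1))
    (r : ℝ) (hr : 0 ≤ r) : r ^ α = r ^ (2 * (k - 1)) ∧ r ^ (2 + α) = r ^ (2 * k) := by
  obtain ⟨m, rfl⟩ := Nat.exists_eq_add_of_le hk
  subst hα
  constructor
  · rw [← Real.rpow_natCast]; congr 1; push_cast; simp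
  · rw [← Real.rpow_natCast]; congr 1; push_cast; ring

/-- the model solution (k = 1) -/
def Fm (c₀ c₁ c₂ p q : ℝ) : ℝ :=
  (c₀ * (1 - (p ^ 2 + q ^ 2)) + (c₁ * p + c₂ * q)) / (1 + (p ^ 2 + q ^ 2))

lemma linSol_eq (k : ℕ) (hk : 1 ≤ k) (α : ℝ) (hα : α = 2 * ((k : ℝ) - 1)) (c₀ c₁ c₂ : ℝ)
    (x : EuclideanSpace ℝ (Fin 2)) :
    linSol α k c₀ c₁ c₂ x = Fm c₀ c₁ c₂ (zc x ^ k).re (zc x ^ k).im := by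
  have h2 := (norm_pow_alpha k hk α hα ‖x‖ (norm_nonneg _)).2
  have h3 : ‖x‖ ^ (2 * k) = (zc x ^ k).re ^ 2 + (zc x ^ k).im ^ 2 := by
    rw [← zc_norm, mul_comm, pow_mul, ← norm_pow, ← Complex.normSq_eq_norm_sq,
      Complex.normSq_apply]
    ring
  unfold linSol Fm
  rw [h2, h3, ← add_div]
  rfl

/-- first derivative of the model along a curve -/
def Fm1 (c₀ c₁ c₂ p q a b : ℝ) : ℝ :=
  ((-c₀ * (2 * p * a + 2 * q * b) + (c₁ * a + c₂ * b)) * (1 + (p ^ 2 + q ^ 2))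
    - (c₀ * (1 - (p ^ 2 + q ^ 2)) + (c₁ * p + c₂ * q)) * (2 * p * a + 2 * q * b))
    / (1 + (p ^ 2 + q ^ 2)) ^ 2

def Fm2 (c₀ c₁ c₂ p q a b a2 b2 : ℝ) : ℝ :=
  (((-c₀ * (2 * a * a + 2 * p * a2 + 2 * b * b + 2 * q * b2) + (c₁ * a2 + c₂ * b2))
      * (1 + (p ^ 2 + q ^ 2))
    - (c₀ * (1 - (p ^ 2 + q ^ 2)) + (c₁ * p + c₂ * q))
      * (2 * a * a + 2 * p * a2 + 2 * b * b + 2 * q * b2)) * (1 + (p ^ 2 + q ^ 2))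
    - 2 * ((-c₀ * (2 * p * a + 2 * q * b) + (c₁ * a + c₂ * b)) * (1 + (p ^ 2 + q ^ 2))
    - (c₀ * (1 - (p ^ 2 + q ^ 2)) + (c₁ * p + c₂ * q)) * (2 * p * a + 2 * q * b))
      * (2 * p * a + 2 * q * b))
    / (1 + (p ^ 2 + q ^ 2)) ^ 3

lemma Fm_deriv (c₀ c₁ c₂ : ℝ) (p q : ℝ → ℝ) (a b t : ℝ) (hp : HasDerivAt p a t)
    (hq : HasDerivAt q b t) :
    HasDerivAt (fun s => Fm c₀ c₁ c₂ (p s) (q s)) (Fm1 c₀ c₁ c₂ (p t) (q t) a b) t := by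
  have hpos : (1 + (p t ^ 2 + q t ^ 2)) ≠ 0 := by positivity
  have hr : HasDerivAt (fun s => p s ^ 2 + q s ^ 2) (2 * p t * a + 2 * q t * b) t := by
    refine ((hp.pow 2).add (hq.pow 2)).congr_deriv ?_
    simp
  have := (((hr.const_sub 1).const_mul c₀).add ((hp.const_mul c₁).add (hq.const_mul c₂))).div
    (hr.const_add 1) hpos
  refine this.congr_deriv ?_
  unfold Fm1
  simp only [Pi.add_apply]
  congr 1
  ring

lemma Fm1_deriv (c₀ c₁ c₂ : ℝ) (p q a b : ℝ → ℝ) (a2 b2 t : ℝ) (hp : HasDerivAt p (a t) t)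
    (hq : HasDerivAt q (b t) t) (ha : HasDerivAt a a2 t) (hb : HasDerivAt b b2 t) :
    HasDerivAt (fun s => Fm1 c₀ c₁ c₂ (p s) (q s) (a s) (b s))
      (Fm2 c₀ c₁ c₂ (p t) (q t) (a t) (b t) a2 b2) t := by
  have hpos : (1 + (p t ^ 2 + q t ^ 2)) ≠ 0 := by positivity
  have hpos2 : (1 + (p t ^ 2 + q t ^ 2)) ^ 2 ≠ 0 := by positivity
  have hr : HasDerivAt (fun s => p s ^ 2 + q s ^ 2) (2 * p t * a t + 2 * q t * b t) t := by
    refine ((hp.pow 2).add (hq.pow 2)).congr_deriv ?_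
    simp
  have hr2 : HasDerivAt (fun s => 2 * p s * a s + 2 * q s * b s)
      (2 * a t * a t + 2 * p t * a2 + 2 * b t * b t + 2 * q t * b2) t := by
    refine (((hp.const_mul 2).mul ha).add ((hq.const_mul 2).mul hb)).congr_deriv ?_
    ring
  have hN := ((hr2.const_mul (-c₀)).add ((ha.const_mul c₁).add (hb.const_mul c₂)))
  have hM := ((hr.const_sub 1).const_mul c₀).add ((hp.const_mul c₁).add (hq.const_mul c₂))
  have := (((hN.mul (hr.const_add 1)).sub (hM.mul hr2))).div
    ((hr.const_add 1).pow 2) hpos2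
  refine this.congr_deriv ?_
  unfold Fm2
  simp only [Pi.add_apply, Pi.mul_apply, Pi.sub_apply, Pi.pow_apply]
  rw [div_eq_div_iff (by positivity) (by positivity)]
  push_cast
  ring

lemma zc_line (x : EuclideanSpace ℝ (Fin 2)) (i : Fin 2) (t : ℝ) :
    zc (x + t • EuclideanSpace.single i (1 : ℝ)) =
      zc x + (t : ℂ) * (if i = 0 then 1 else Complex.I) := by
  fin_cases i <;> simp [zc] <;> ring

lemma pow_line_deriv (m : ℕ) (z d : ℂ) (C : ℂ) (t : ℝ) :
    HasDerivAt (fun s : ℝ => (C * (z + (s : ℂ) * d) ^ m).re)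
      (C * (m * (z + (t : ℂ) * d) ^ (m - 1) * d)).re t ∧
    HasDerivAt (fun s : ℝ => (C * (z + (s : ℂ) * d) ^ m).im)
      (C * (m * (z + (t : ℂ) * d) ^ (m - 1) * d)).im t := by
  have h : HasDerivAt (fun s : ℝ => C * (z + (s : ℂ) * d) ^ m)
      (C * (m * (z + (t : ℂ) * d) ^ (m - 1) * d)) t := by
    have h1 : HasDerivAt (fun s : ℝ => z + (s : ℂ) * d) d t := by
      simpa using ((Complex.ofRealCLM.hasDerivAt (x := t)).mul_const d).const_add z
    exact (h1.pow m).const_mul C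
  exact ⟨(Complex.reCLM.hasFDerivAt.comp_hasDerivAt t h), (Complex.imCLM.hasFDerivAt.comp_hasDerivAt t h)⟩

lemma linSol_contDiff (k : ℕ) (hk : 1 ≤ k) (α : ℝ) (hα : α = 2 * ((k : ℝ) - 1)) (c₀ c₁ c₂ : ℝ) :
    ContDiff ℝ 2 (linSol α k c₀ c₁ c₂) := by
  have : linSol α k c₀ c₁ c₂ = fun x => Fm c₀ c₁ c₂ (zc x ^ k).re (zc x ^ k).im :=
    funext (linSol_eq k hk α hα c₀ c₁ c₂)
  rw [this]
  have hz : ContDiff ℝ 2 zc := by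
    unfold zc
    have h0 : ∀ i : Fin 2, ContDiff ℝ 2 (fun x : EuclideanSpace ℝ (Fin 2) => ((x i : ℝ) : ℂ)) :=
      fun i => Complex.ofRealCLM.contDiff.comp (by fun_prop)
    exact (h0 0).add ((h0 1).mul contDiff_const)
  have hp : ContDiff ℝ 2 (fun x => (zc x ^ k).re) := Complex.reCLM.contDiff.comp (hz.pow k)
  have hq : ContDiff ℝ 2 (fun x => (zc x ^ k).im) := Complex.imCLM.contDiff.comp (hz.pow k)
  unfold Fm
  refine ContDiff.div ?_ ?_ (fun x => by positivity)
  · fun_prop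
  · fun_prop

lemma linSol_line (k : ℕ) (hk : 1 ≤ k) (α : ℝ) (hα : α = 2 * ((k : ℝ) - 1)) (c₀ c₁ c₂ : ℝ)
    (x : EuclideanSpace ℝ (Fin 2)) (i : Fin 2) (d : ℂ) (hd : d = if i = 0 then 1 else Complex.I) :
    HasDerivAt (fun t : ℝ => linSol α k c₀ c₁ c₂ (x + t • EuclideanSpace.single i (1 : ℝ)))
      (Fm1 c₀ c₁ c₂ (zc x ^ k).re (zc x ^ k).im (k * zc x ^ (k - 1) * d).re
        (k * zc x ^ (k - 1) * d).im) 0 ∧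
    deriv (deriv (fun t : ℝ => linSol α k c₀ c₁ c₂ (x + t • EuclideanSpace.single i (1 : ℝ)))) 0 =
      Fm2 c₀ c₁ c₂ (zc x ^ k).re (zc x ^ k).im (k * zc x ^ (k - 1) * d).re
        (k * zc x ^ (k - 1) * d).im (k * d * ((k - 1 : ℕ) * zc x ^ (k - 1 - 1) * d)).re
        (k * d * ((k - 1 : ℕ) * zc x ^ (k - 1 - 1) * d)).im := by
  have h0 : (fun t : ℝ => linSol α k c₀ c₁ c₂ (x + t • EuclideanSpace.single i (1 : ℝ))) =
      fun t : ℝ => Fm c₀ c₁ c₂ ((zc x + t * d) ^ k).re ((zc x + t * d) ^ k).im := by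
    funext t; rw [linSol_eq k hk α hα, zc_line, hd]
  have h1 : ∀ t : ℝ, HasDerivAt (fun s : ℝ => ((zc x + s * d) ^ k).re)
      (k * d * (zc x + t * d) ^ (k - 1)).re t ∧ HasDerivAt (fun s : ℝ => ((zc x + s * d) ^ k).im)
      (k * d * (zc x + t * d) ^ (k - 1)).im t := by
    intro t
    have := pow_line_deriv k (zc x) d 1 t
    simp only [one_mul] at this
    rw [show (k * d * (zc x + t * d) ^ (k - 1)) = k * (zc x + t * d) ^ (k - 1) * d by ring]
    exact this
  have h2 := pow_line_deriv (k - 1) (zc x) d (k * d) 0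
  have h3 : ∀ t : ℝ, HasDerivAt (fun t : ℝ => Fm c₀ c₁ c₂ ((zc x + t * d) ^ k).re
      ((zc x + t * d) ^ k).im) (Fm1 c₀ c₁ c₂ ((zc x + t * d) ^ k).re
      ((zc x + t * d) ^ k).im (k * d * (zc x + t * d) ^ (k - 1)).re
      (k * d * (zc x + t * d) ^ (k - 1)).im) t := fun t =>
    Fm_deriv c₀ c₁ c₂ _ _ _ _ t (h1 t).1 (h1 t).2
  have e : (k * zc x ^ (k - 1) * d) = k * d * (zc x + (0 : ℝ) * d) ^ (k - 1) := by
    simp; ring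
  rw [h0]
  constructor
  · have := h3 0
    rw [e]
    simpa using this
  · rw [deriv_eq h3]
    have := (Fm1_deriv c₀ c₁ c₂ _ _ _ _ _ _ 0 (h1 0).1 (h1 0).2 h2.1 h2.2).deriv
    rw [this, e]
    simp

lemma linSol_pde (k : ℕ) (hk : 1 ≤ k) (α : ℝ) (hα : α = 2 * ((k : ℝ) - 1)) (c₀ c₁ c₂ : ℝ)
    (x : EuclideanSpace ℝ (Fin 2)) :
    planeLaplacian (linSol α k c₀ c₁ c₂) x
          + 2 * (α + 2) ^ 2 * (‖x‖ ^ α / (1 + ‖x‖ ^ (2 + α)) ^ 2) *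
            linSol α k c₀ c₁ c₂ x = 0 := by
  obtain ⟨n1, n2⟩ := norm_pow_alpha k hk α hα ‖x‖ (norm_nonneg _)
  have h3 : ‖x‖ ^ (2 * k) = (zc x ^ k).re ^ 2 + (zc x ^ k).im ^ 2 := by
    rw [← zc_norm, mul_comm, pow_mul, ← norm_pow, ← Complex.normSq_eq_norm_sq,
      Complex.normSq_apply]
    ring
  have h4 : ‖x‖ ^ (2 * (k - 1)) = (zc x ^ (k - 1)).re ^ 2 + (zc x ^ (k - 1)).im ^ 2 := by
    rw [← zc_norm, mul_comm, pow_mul, ← norm_pow, ← Complex.normSq_eq_norm_sq,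
      Complex.normSq_apply]
    ring
  unfold planeLaplacian
  rw [Fin.sum_univ_two, (linSol_line k hk α hα c₀ c₁ c₂ x 0 1 (by simp)).2,
    (linSol_line k hk α hα c₀ c₁ c₂ x 1 Complex.I (by simp)).2, linSol_eq k hk α hα, n1, n2, h3, h4]
  have hα2 : α + 2 = 2 * k := by rw [hα]; ring
  rw [hα2]
  have e2 : (k * Complex.I * ((k - 1 : ℕ) * zc x ^ (k - 1 - 1) * Complex.I)) =
     - (k * 1 * ((k - 1 : ℕ) * zc x ^ (k - 1 - 1) * 1)) := by
    linear_combination (k * ((k - 1 : ℕ) * zc x ^ (k - 1 - 1))) * Complex.I_mul_I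
  rw [e2]
  generalize (k * 1 * ((k - 1 : ℕ) * zc x ^ (k - 1 - 1) * 1) : ℂ) = w
  generalize zc x ^ k = P
  generalize zc x ^ (k - 1) = Z
  have r1 : (k * Z * 1 : ℂ).re = k * Z.re := by simp
  have r2 : (k * Z * 1 : ℂ).im = k * Z.im := by simp
  have r3 : (k * Z * Complex.I : ℂ).re = - (k * Z.im) := by simp
  have r4 : (k * Z * Complex.I : ℂ).im = k * Z.re := by simp
  rw [r1, r2, r3, r4, Complex.neg_re, Complex.neg_im]
  unfold Fm2 Fm
  have hpos : 1 + (P.re ^ 2 + P.im ^ 2) ≠ 0 := by positivity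
  field_simp
  ring

lemma fderiv_norm_le (L : EuclideanSpace ℝ (Fin 2) →L[ℝ] ℝ) :
    ‖L‖ ≤ |L (EuclideanSpace.single 0 1)| + |L (EuclideanSpace.single 1 1)| := by
  refine L.opNorm_le_bound (by positivity) fun x => ?_
  have hx : x = x 0 • EuclideanSpace.single 0 (1 : ℝ) + x 1 • EuclideanSpace.single 1 (1 : ℝ) := by
    ext i; fin_cases i <;> simp
  have h0 := EuclideanSpace.norm_eq x
  have a0 : ‖x 0‖ ≤ ‖x‖ := PiLp.norm_apply_le x 0
  have a1 : ‖x 1‖ ≤ ‖x‖ := PiLp.norm_apply_le x 1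
  conv_lhs => rw [hx]
  rw [map_add, map_smul, map_smul, smul_eq_mul, smul_eq_mul]
  refine (norm_add_le _ _).trans ?_
  rw [norm_mul, norm_mul, Real.norm_eq_abs (L _), Real.norm_eq_abs (L _), add_mul]
  rw [mul_comm ‖x 0‖, mul_comm ‖x 1‖]
  gcongr

lemma Fm1_bound (c₀ c₁ c₂ p q a b : ℝ) (A : ℝ) (hA : 0 ≤ A) (ha : |a| ≤ A) (hb : |b| ≤ A) :
    |Fm1 c₀ c₁ c₂ p q a b| ≤ 8 * (|c₀| + |c₁| + |c₂|) * A / (1 + (p ^ 2 + q ^ 2)) := by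
  have hS : 0 < 1 + (p ^ 2 + q ^ 2) := by positivity
  set S := 1 + (p ^ 2 + q ^ 2) with hSd
  have hp : |p| * 2 ≤ S := by rw [hSd, ← sq_abs p, ← sq_abs q]; nlinarith [sq_nonneg (|p| - 1), sq_nonneg (|q|)]
  have hq : |q| * 2 ≤ S := by rw [hSd, ← sq_abs p, ← sq_abs q]; nlinarith [sq_nonneg (|q| - 1), sq_nonneg (|p|)]
  have key : Fm1 c₀ c₁ c₂ p q a b = (-4 * c₀ * (p * a + q * b) + (c₁ * a + c₂ * b) * S
      - (c₁ * p + c₂ * q) * (2 * p * a + 2 * q * b)) / S ^ 2 := by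
    unfold Fm1
    rw [← hSd]
    congr 1
    rw [hSd]
    ring
  rw [key, abs_div, abs_of_pos (show 0 < S ^ 2 by positivity), div_le_div_iff₀ (by positivity) hS]
  have hpp : p ^ 2 ≤ S := by rw [hSd]; nlinarith [sq_nonneg q]
  have hqq : q ^ 2 ≤ S := by rw [hSd]; nlinarith [sq_nonneg p]
  have hpq : |p| * |q| ≤ S / 2 := by
    rw [hSd, ← sq_abs p, ← sq_abs q]; nlinarith [sq_nonneg (|p| - |q|)]
  have t1 : |p * a + q * b| ≤ S * A := by
    refine (abs_add_le _ _).trans ?_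
    rw [abs_mul, abs_mul]
    have := mul_le_mul hp ha (abs_nonneg _) hS.le
    have := mul_le_mul hq hb (abs_nonneg _) hS.le
    linarith
  have t2 : |c₁ * a + c₂ * b| ≤ (|c₁| + |c₂|) * A := by
    refine (abs_add_le _ _).trans ?_
    rw [abs_mul, abs_mul, add_mul]
    gcongr
  have t3 : |(c₁ * p + c₂ * q) * (2 * p * a + 2 * q * b)| ≤ 4 * (|c₁| + |c₂|) * A * S := by
    have : (c₁ * p + c₂ * q) * (2 * p * a + 2 * q * b) =
      2 * (c₁ * (p ^ 2 * a + p * q * b) + c₂ * (p * q * a + q ^ 2 * b)) := by ring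
    rw [this, abs_mul, abs_two]
    have u1 : |p ^ 2 * a + p * q * b| ≤ 2 * A * S := by
      refine (abs_add_le _ _).trans ?_
      rw [abs_mul, abs_mul, abs_mul p q, abs_of_nonneg (sq_nonneg p)]
      have := mul_le_mul hpp ha (abs_nonneg _) hS.le
      have := mul_le_mul hpq hb (abs_nonneg _) (by linarith)
      nlinarith [mul_nonneg hA hS.le]
    have u2 : |p * q * a + q ^ 2 * b| ≤ 2 * A * S := by
      refine (abs_add_le _ _).trans ?_
      rw [abs_mul (p * q) a, abs_mul p q, abs_mul (q ^ 2) b, abs_of_nonneg (sq_nonneg q)]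
      have := mul_le_mul hqq hb (abs_nonneg _) hS.le
      have := mul_le_mul hpq ha (abs_nonneg _) (by linarith)
      nlinarith [mul_nonneg hA hS.le]
    have := abs_add_le (c₁ * (p ^ 2 * a + p * q * b)) (c₂ * (p * q * a + q ^ 2 * b))
    rw [abs_mul, abs_mul] at this
    have := mul_le_mul_of_nonneg_left u1 (abs_nonneg c₁)
    have := mul_le_mul_of_nonneg_left u2 (abs_nonneg c₂)
    nlinarith
  have := abs_sub (-4 * c₀ * (p * a + q * b) + (c₁ * a + c₂ * b) * S) ((c₁ * p + c₂ * q) * (2 * p * a + 2 * q * b))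
  have := abs_add_le (-4 * c₀ * (p * a + q * b)) ((c₁ * a + c₂ * b) * S)
  have s1 : |-4 * c₀ * (p * a + q * b)| ≤ 4 * |c₀| * (S * A) := by
    rw [abs_mul, abs_mul]; norm_num; gcongr
  have s2 : |(c₁ * a + c₂ * b) * S| ≤ (|c₁| + |c₂|) * A * S := by
    rw [abs_mul, abs_of_pos hS]; gcongr
  have : |(-4 * c₀ * (p * a + q * b) + (c₁ * a + c₂ * b) * S
      - (c₁ * p + c₂ * q) * (2 * p * a + 2 * q * b))| ≤ 8 * (|c₀| + |c₁| + |c₂|) * A * S := by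
    have := mul_nonneg (abs_nonneg c₀) (mul_nonneg hA hS.le)
    have := mul_nonneg (abs_nonneg c₁) (mul_nonneg hA hS.le)
    have := mul_nonneg (abs_nonneg c₂) (mul_nonneg hA hS.le)
    nlinarith
  nlinarith

lemma linSol_energy (k : ℕ) (hk : 1 ≤ k) (α : ℝ) (hα : α = 2 * ((k : ℝ) - 1)) (c₀ c₁ c₂ : ℝ) :
    Integrable (fun x : EuclideanSpace ℝ (Fin 2) =>
        ‖fderiv ℝ (linSol α k c₀ c₁ c₂) x‖ ^ 2) := by
  have hC := linSol_contDiff k hk α hα c₀ c₁ c₂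
  set M := 8 * (|c₀| + |c₁| + |c₂|) with hM
  have hM0 : 0 ≤ M := by positivity
  have hint : Integrable (fun x : EuclideanSpace ℝ (Fin 2) =>
      (4 * M * k) ^ 2 * (1 + ‖x‖ ^ 2) ^ (-(4 : ℝ) / 2)) :=
    (integrable_rpow_neg_one_add_norm_sq (by simp; norm_num)).const_mul _
  refine hint.mono' ?_ (Filter.Eventually.of_forall fun x => ?_)
  · exact ((hC.continuous_fderiv (by norm_num)).norm.pow 2).aestronglyMeasurable
  have hdiff := (hC.differentiable (by norm_num)) x
  have hdir : ∀ i : Fin 2, |fderiv ℝ (linSol α k c₀ c₁ c₂) x (EuclideanSpace.single i 1)| ≤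
      M * (k * ‖x‖ ^ (k - 1)) / (1 + ‖x‖ ^ (2 * k)) := by
    intro i
    have h1 := (linSol_line k hk α hα c₀ c₁ c₂ x i _ rfl).1
    have h2 : HasDerivAt (fun t : ℝ => linSol α k c₀ c₁ c₂ (x + t • EuclideanSpace.single i (1 : ℝ)))
        (fderiv ℝ (linSol α k c₀ c₁ c₂) x (EuclideanSpace.single i 1)) 0 :=
      hdiff.hasFDerivAt.hasLineDerivAt (EuclideanSpace.single i 1)
    rw [h2.unique h1]
    have h3 : ‖x‖ ^ (2 * k) = (zc x ^ k).re ^ 2 + (zc x ^ k).im ^ 2 := by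
      rw [← zc_norm, mul_comm, pow_mul, ← norm_pow, ← Complex.normSq_eq_norm_sq,
        Complex.normSq_apply]
      ring
    have hn : ‖(k * zc x ^ (k - 1) * (if i = 0 then 1 else Complex.I) : ℂ)‖ = k * ‖x‖ ^ (k - 1) := by
      rw [norm_mul, norm_mul, norm_pow, zc_norm]
      split_ifs <;> simp
    rw [h3]
    refine Fm1_bound _ _ _ _ _ _ _ _ (by positivity) ?_ ?_
    · rw [← hn]; exact Complex.abs_re_le_norm _
    · rw [← hn]; exact Complex.abs_im_le_norm _
  have hb := fderiv_norm_le (fderiv ℝ (linSol α k c₀ c₁ c₂) x)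
  have hr : ‖x‖ ^ (k - 1) * (1 + ‖x‖ ^ 2) ≤ 2 * (1 + ‖x‖ ^ (2 * k)) := by
    have hx := norm_nonneg x
    have e : ∀ j ≤ 2 * k, ‖x‖ ^ j ≤ 1 + ‖x‖ ^ (2 * k) := by
      intro j hj
      rcases le_total ‖x‖ 1 with h | h
      · have := pow_le_one₀ (n := j) hx h
        have : 0 ≤ ‖x‖ ^ (2 * k) := by positivity
        linarith
      · have := pow_le_pow_right₀ h hj
        linarith
    have e1 := e (k - 1) (by omega)
    have e2 := e (k - 1 + 2) (by omega)
    rw [pow_add] at e2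
    linarith
  have hfin : ‖fderiv ℝ (linSol α k c₀ c₁ c₂) x‖ ≤ 4 * M * k / (1 + ‖x‖ ^ 2) := by
    have : M * (k * ‖x‖ ^ (k - 1)) / (1 + ‖x‖ ^ (2 * k)) ≤ 2 * M * k / (1 + ‖x‖ ^ 2) := by
      rw [div_le_div_iff₀ (by positivity) (by positivity)]
      have := mul_le_mul_of_nonneg_left hr (show 0 ≤ M * k by positivity)
      linarith
    have h0 := hdir 0
    have h1 := hdir 1
    calc _ ≤ _ := hb
      _ ≤ 2 * M * k / (1 + ‖x‖ ^ 2) + 2 * M * k / (1 + ‖x‖ ^ 2) := by linarith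
      _ = _ := by ring
  rw [Real.norm_of_nonneg (by positivity)]
  have : (1 + ‖x‖ ^ 2) ^ (-(4 : ℝ) / 2) = ((1 + ‖x‖ ^ 2) ^ 2)⁻¹ := by
    rw [show (-(4 : ℝ) / 2) = -((2 : ℕ) : ℝ) by norm_num, Real.rpow_neg (by positivity), Real.rpow_natCast]
  rw [this, ← div_eq_mul_inv, ← div_pow]
  gcongr

/-- the radial solution in logarithmic coordinates -/
def Hh (k : ℕ) (t : ℝ) : ℝ := (1 - Real.exp (2 * k * t)) / (1 + Real.exp (2 * k * t))

lemma Hh_deriv (k : ℕ) (t : ℝ) : HasDerivAt (Hh k) (k * (Hh k t ^ 2 - 1)) t := by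
  have he : HasDerivAt (fun t : ℝ => Real.exp (2 * k * t)) (Real.exp (2 * k * t) * (2 * k)) t := by
    have h1 : HasDerivAt (fun t : ℝ => 2 * k * t) (2 * k : ℝ) t := by
      simpa using (hasDerivAt_id t).const_mul (2 * k : ℝ)
    exact h1.exp
  have hpos : 1 + Real.exp (2 * k * t) ≠ 0 := by positivity
  have := (he.const_sub 1).div (he.const_add 1) hpos
  refine this.congr_deriv ?_
  unfold Hh
  field_simp
  ring

lemma Hh_abs (k : ℕ) (t : ℝ) : |Hh k t| ≤ 1 := by
  unfold Hh
  have := Real.exp_pos (2 * k * t)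
  rw [abs_div, abs_of_pos (by positivity : 0 < 1 + Real.exp (2 * k * t)), div_le_one (by positivity),
    abs_le]
  constructor <;> linarith

lemma Hh_q (k : ℕ) (t : ℝ) :
    8 * (k : ℝ) ^ 2 * (Real.exp (2 * k * t) / (1 + Real.exp (2 * k * t)) ^ 2)
      = 2 * k ^ 2 * (1 - Hh k t ^ 2) := by
  unfold Hh
  have hpos : 1 + Real.exp (2 * k * t) ≠ 0 := by positivity
  field_simp
  ring

section ode
variable (k : ℕ) (N : ℝ) (f f1 : ℝ → ℂ)

/-- Darboux transform -/
def gg (t : ℝ) : ℂ := f1 t - (k * Hh k t : ℝ) * f t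

def gg1 (t : ℝ) : ℂ := ((N - k ^ 2 : ℝ) : ℂ) * f t - (k * Hh k t : ℝ) * gg k f f1 t

lemma gg_deriv (hf : ∀ t, HasDerivAt f (f1 t) t)
    (hf1 : ∀ t, HasDerivAt f1 (((N - 2 * k ^ 2 * (1 - Hh k t ^ 2) : ℝ) : ℂ) * f t) t) (t : ℝ) :
    HasDerivAt (gg k f f1) (gg1 k N f f1 t) t := by
  have h := (hf1 t).sub ((((Hh_deriv k t).const_mul (k : ℝ)).ofReal_comp).mul (hf t))
  refine h.congr_deriv ?_
  unfold gg1 gg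
  push_cast
  ring

lemma gg1_deriv (hf : ∀ t, HasDerivAt f (f1 t) t)
    (hf1 : ∀ t, HasDerivAt f1 (((N - 2 * k ^ 2 * (1 - Hh k t ^ 2) : ℝ) : ℂ) * f t) t) (t : ℝ) :
    HasDerivAt (gg1 k N f f1) (N * gg k f f1 t) t := by
  have h := ((hf t).const_mul (((N - k ^ 2 : ℝ) : ℂ))).sub
    ((((Hh_deriv k t).const_mul (k : ℝ)).ofReal_comp).mul (gg_deriv k N f f1 hf hf1 t))
  refine h.congr_deriv ?_
  unfold gg1 gg
  push_cast
  ring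

lemma const_of_deriv_zero (F : ℝ → ℂ) (h : ∀ t, HasDerivAt F 0 t) (s t : ℝ) : F s = F t :=
  is_const_of_deriv_eq_zero (fun t => (h t).differentiableAt) (fun t => (h t).deriv) s t

lemma exp_deriv (c t : ℝ) : HasDerivAt (fun t : ℝ => (Real.exp (c * t) : ℂ))
    ((Real.exp (c * t) * c : ℝ) : ℂ) t := by
  have h1 : HasDerivAt (fun t : ℝ => c * t) c t := by
    simpa using (hasDerivAt_id t).const_mul c
  exact h1.exp.ofReal_comp

/-- positive modes: bounded at `-∞` forces pure growth. -/
lemma growth (m C : ℝ) (hm : 0 < m) (g g1 : ℝ → ℂ) (hg : ∀ t, HasDerivAt g (g1 t) t)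
    (hg1 : ∀ t, HasDerivAt g1 (((m ^ 2 : ℝ) : ℂ) * g t) t)
    (hb : ∀ t ≤ 0, ‖g t‖ ≤ C) (hb1 : ∀ t ≤ 0, ‖g1 t‖ ≤ C) :
    ∀ t, g t = g 0 * Real.exp (m * t) := by
  have hC : 0 ≤ C := (norm_nonneg _).trans (hb 0 le_rfl)
  set Q : ℝ → ℂ := fun t => (g1 t - m * g t) * Real.exp (m * t) with hQ
  have hQ0 : ∀ t, HasDerivAt Q 0 t := by
    intro t
    refine (((hg1 t).sub ((hg t).const_mul (m : ℂ))).mul (exp_deriv m t)).congr_deriv ?_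
    simp only [Pi.sub_apply]
    push_cast
    ring
  have hQz : Q 0 = 0 := by
    have hbd : ∀ t ≤ 0, ‖Q 0‖ ≤ (C + m * C) * Real.exp (m * t) := by
      intro t ht
      rw [const_of_deriv_zero Q hQ0 0 t, hQ]
      simp only
      rw [norm_mul, Complex.norm_real, Real.norm_of_nonneg (Real.exp_pos _).le]
      gcongr
      refine (norm_sub_le _ _).trans ?_
      rw [norm_mul, Complex.norm_real, Real.norm_of_nonneg hm.le]
      have := hb t ht
      have := hb1 t ht
      gcongr
    have hlim : Filter.Tendsto (fun t : ℝ => (C + m * C) * Real.exp (m * t)) Filter.atBot (nhds 0) := by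
      have : Filter.Tendsto (fun t : ℝ => Real.exp (m * t)) Filter.atBot (nhds 0) :=
        Real.tendsto_exp_atBot.comp (Filter.tendsto_id.const_mul_atBot hm)
      simpa using this.const_mul (C + m * C)
    have := ge_of_tendsto hlim ((Filter.eventually_le_atBot 0).mono hbd)
    exact norm_le_zero_iff.1 this
  have hgm : ∀ t, g1 t = m * g t := by
    intro t
    have h := const_of_deriv_zero Q hQ0 t 0
    rw [hQz] at h
    have h2 : (Real.exp (m * t) : ℂ) ≠ 0 := by exact_mod_cast (Real.exp_pos _).ne'
    exact sub_eq_zero.1 ((mul_eq_zero.1 h).resolve_right h2)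
  set R : ℝ → ℂ := fun t => g t * Real.exp (-m * t) with hR
  have hR0 : ∀ t, HasDerivAt R 0 t := by
    intro t
    refine ((hg t).mul (exp_deriv (-m) t)).congr_deriv ?_
    rw [hgm]
    push_cast
    ring
  intro t
  have h := const_of_deriv_zero R hR0 t 0
  simp only [hR, mul_zero, Real.exp_zero, Complex.ofReal_one, mul_one] at h
  rw [← h, mul_assoc, ← Complex.ofReal_mul, ← Real.exp_add]
  simp

lemma zero_mode (C : ℝ) (g g1 : ℝ → ℂ) (hg : ∀ t, HasDerivAt g (g1 t) t)
    (hg1 : ∀ t, HasDerivAt g1 0 t)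
    (hb : ∀ t ≤ 0, ‖g t‖ ≤ C) : ∀ t, g1 t = 0 ∧ g t = g 0 := by
  have hc : ∀ t, g1 t = g1 0 := fun t => const_of_deriv_zero g1 hg1 t 0
  have hR0 : ∀ t, HasDerivAt (fun t : ℝ => g t - (t : ℂ) * g1 0) 0 t := by
    intro t
    refine ((hg t).sub ((Complex.ofRealCLM.hasDerivAt (x := t)).mul_const (g1 0))).congr_deriv ?_
    simp [hc t]
  have hC : 0 ≤ C := (norm_nonneg _).trans (hb 0 le_rfl)
  have h0 : g1 0 = 0 := by
    by_contra hne
    have hpos : 0 < ‖g1 0‖ := norm_pos_iff.2 hne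
    set T : ℝ := -((2 * C + 1) / ‖g1 0‖) with hT
    have hT0 : T ≤ 0 := by rw [hT]; have : 0 ≤ (2 * C + 1) / ‖g1 0‖ := by positivity
                           linarith
    have h := const_of_deriv_zero _ hR0 T 0
    simp only [Complex.ofReal_zero, zero_mul, sub_zero] at h
    have h1 : (T : ℂ) * g1 0 = g T - g 0 := by rw [← h]; ring
    have h2 : ‖(T : ℂ) * g1 0‖ = 2 * C + 1 := by
      rw [norm_mul, Complex.norm_real, hT, norm_neg, Real.norm_of_nonneg (by positivity)]
      field_simp
    have h3 := norm_sub_le (g T) (g 0)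
    rw [← h1, h2] at h3
    have := hb T hT0
    have := hb 0 le_rfl
    linarith
  intro t
  refine ⟨by rw [hc, h0], ?_⟩
  have h := const_of_deriv_zero _ hR0 t 0
  simpa [h0] using h

/-- zero transform: `f` is a multiple of `sech` -/
lemma sech_mode (hf : ∀ t, HasDerivAt f (f1 t) t) (hg : ∀ t, gg k f f1 t = 0) (t : ℝ) :
    f t = 2 * f 0 * ((Real.exp (k * t) / (1 + Real.exp (2 * k * t)) : ℝ) : ℂ) := by
  have hR0 : ∀ t, HasDerivAt (fun t : ℝ => f t * ((Real.exp (-k * t) : ℂ) + (Real.exp (k * t) : ℂ))) 0 t := by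
    intro t
    refine ((hf t).mul ((exp_deriv (-k) t).add (exp_deriv k t))).congr_deriv ?_
    have h := hg t
    unfold gg at h
    rw [sub_eq_zero.1 h]
    have e : Hh k t * (Real.exp (-k * t) + Real.exp (k * t)) = Real.exp (-k * t) - Real.exp (k * t) := by
      unfold Hh
      have e1 : Real.exp (2 * k * t) = Real.exp (k * t) * Real.exp (k * t) := by
        rw [← Real.exp_add]; ring_nf
      have e2 : Real.exp (-k * t) = (Real.exp (k * t))⁻¹ := by
        rw [← Real.exp_neg]; ring_nf
      have := Real.exp_pos (k * t)
      rw [e1, e2]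
      field_simp
    have e' : (Hh k t : ℂ) * (Real.exp (-k * t) + Real.exp (k * t)) = Real.exp (-k * t) - Real.exp (k * t) := by
      exact_mod_cast congrArg (fun x : ℝ => (x : ℂ)) e
    simp only [Pi.add_apply]
    push_cast at e' ⊢
    linear_combination (k : ℂ) * f t * e'
  have h := const_of_deriv_zero _ hR0 t 0
  simp only [mul_zero, Real.exp_zero, Complex.ofReal_one] at h
  have e1 : Real.exp (2 * k * t) = Real.exp (k * t) * Real.exp (k * t) := by
    rw [← Real.exp_add]; ring_nf
  have e2 : Real.exp (-k * t) = (Real.exp (k * t))⁻¹ := by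
    rw [← Real.exp_neg]; ring_nf
  have h5 := Real.exp_pos (k * t)
  rw [e2] at h
  rw [e1]
  generalize Real.exp (k * t) = y at *
  have hy : (y : ℂ) ≠ 0 := by exact_mod_cast h5.ne'
  have hy2 : (1 + y * y : ℂ) ≠ 0 := by
    have : (1 + y * y : ℝ) ≠ 0 := by positivity
    exact_mod_cast this
  push_cast at h ⊢
  rw [mul_div_assoc', eq_div_iff hy2]
  field_simp at h
  linear_combination h

end ode

/-- differentiation under the integral sign, smooth case -/
lemma param_deriv (a b : ℝ) (G G' : ℝ → ℝ → ℂ) (hG : Continuous (Function.uncurry G))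
    (hG' : Continuous (Function.uncurry G')) (h : ∀ t θ, HasDerivAt (fun s => G s θ) (G' t θ) t)
    (t : ℝ) : HasDerivAt (fun t => ∫ θ in a..b, G t θ) (∫ θ in a..b, G' t θ) t := by
  obtain ⟨C, hC⟩ := ((isCompact_Icc (a := t - 1) (b := t + 1)).prod
    (isCompact_uIcc (a := a) (b := b))).exists_bound_of_continuousOn hG'.continuousOn
  have c1 : ∀ s, Continuous (G s) := fun s => hG.comp (by fun_prop : Continuous fun θ => (s, θ))
  have c2 : ∀ s, Continuous (G' s) := fun s => hG'.comp (by fun_prop : Continuous fun θ => (s, θ))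
  refine (intervalIntegral.hasDerivAt_integral_of_dominated_loc_of_deriv_le
    (F := G) (F' := G') (bound := fun _ => C) (s := Icc (t - 1) (t + 1))
    (Icc_mem_nhds (by linarith) (by linarith)) ?_ ?_ ?_ ?_ ?_ ?_).2
  · exact Filter.Eventually.of_forall fun s => (c1 s).aestronglyMeasurable
  · exact (c1 t).intervalIntegrable _ _
  · exact (c2 t).aestronglyMeasurable
  · exact Filter.Eventually.of_forall fun θ hθ s hs => hC (s, θ) ⟨hs, uIoc_subset_uIcc hθ⟩
  · exact intervalIntegrable_const
  · exact Filter.Eventually.of_forall fun θ hθ s hs => h s θ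

/-- log-polar coordinates -/
def pe (t θ : ℝ) : EuclideanSpace ℝ (Fin 2) :=
  (Real.exp t * Real.cos θ) • EuclideanSpace.single 0 (1 : ℝ)
    + (Real.exp t * Real.sin θ) • EuclideanSpace.single 1 (1 : ℝ)

def pj (t θ : ℝ) : EuclideanSpace ℝ (Fin 2) :=
  (-(Real.exp t * Real.sin θ)) • EuclideanSpace.single 0 (1 : ℝ)
    + (Real.exp t * Real.cos θ) • EuclideanSpace.single 1 (1 : ℝ)

lemma pe_cont : Continuous fun p : ℝ × ℝ => pe p.1 p.2 := by unfold pe; fun_prop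

lemma pj_cont : Continuous fun p : ℝ × ℝ => pj p.1 p.2 := by unfold pj; fun_prop

lemma zc_pe (t θ : ℝ) : zc (pe t θ) = Real.exp t * Complex.exp (θ * Complex.I) := by
  rw [Complex.exp_mul_I]
  simp [zc, pe]
  ring

lemma pe_norm (t θ : ℝ) : ‖pe t θ‖ = Real.exp t := by
  rw [← zc_norm, zc_pe, norm_mul, Complex.norm_exp_ofReal_mul_I, Complex.norm_real]
  simp

lemma zc_pj (t θ : ℝ) : zc (pj t θ) = Real.exp t * Complex.exp (θ * Complex.I) * Complex.I := by
  rw [Complex.exp_mul_I]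
  simp [zc, pj]
  linear_combination (-(Complex.exp t * Complex.sin θ)) * Complex.I_mul_I

lemma pj_norm (t θ : ℝ) : ‖pj t θ‖ = Real.exp t := by
  rw [← zc_norm, zc_pj, norm_mul, norm_mul, Complex.norm_exp_ofReal_mul_I, Complex.norm_real]
  simp

lemma pe_periodic (t θ : ℝ) : pe t (θ + 2 * Real.pi) = pe t θ := by simp [pe]

lemma pj_periodic (t θ : ℝ) : pj t (θ + 2 * Real.pi) = pj t θ := by simp [pj]

lemma pe_dt (t θ : ℝ) : HasDerivAt (fun s => pe s θ) (pe t θ) t := by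
  unfold pe
  exact (((Real.hasDerivAt_exp t).mul_const _).smul_const _).add
    (((Real.hasDerivAt_exp t).mul_const _).smul_const _)

lemma pe_dθ (t θ : ℝ) : HasDerivAt (fun s => pe t s) (pj t θ) θ := by
  unfold pe pj
  refine ((((Real.hasDerivAt_cos θ).const_mul (Real.exp t)).smul_const _).add
    (((Real.hasDerivAt_sin θ).const_mul (Real.exp t)).smul_const _)).congr_deriv ?_
  rw [mul_neg]

lemma pj_dθ (t θ : ℝ) : HasDerivAt (fun s => pj t s) (-pe t θ) θ := by
  unfold pe pj
  refine (((((Real.hasDerivAt_sin θ).const_mul (Real.exp t)).neg).smul_const _).add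
    (((Real.hasDerivAt_cos θ).const_mul (Real.exp t)).smul_const _)).congr_deriv ?_
  rw [mul_neg, neg_smul, neg_smul, neg_add]

lemma exists_pe (x : EuclideanSpace ℝ (Fin 2)) (hx : x ≠ 0) : ∃ t θ, x = pe t θ := by
  have hz : zc x ≠ 0 := by rw [← norm_ne_zero_iff, zc_norm]; exact norm_ne_zero_iff.2 hx
  refine ⟨Real.log ‖zc x‖, (zc x).arg, ?_⟩
  have h : zc x = zc (pe (Real.log ‖zc x‖) (zc x).arg) := by
    rw [zc_pe, Real.exp_log (norm_pos_iff.2 hz), Complex.norm_mul_exp_arg_mul_I]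
  have h0 := congrArg Complex.re h
  have h1 := congrArg Complex.im h
  generalize pe (Real.log ‖zc x‖) (zc x).arg = y at *
  simp [zc] at h0 h1
  ext i
  fin_cases i
  · exact h0
  · exact h1

section pde
variable (v : EuclideanSpace ℝ (Fin 2) → ℝ)

def Vt (t θ : ℝ) : ℝ := fderiv ℝ v (pe t θ) (pe t θ)
def Vθ (t θ : ℝ) : ℝ := fderiv ℝ v (pe t θ) (pj t θ)
def Vtt (t θ : ℝ) : ℝ :=
  fderiv ℝ (fderiv ℝ v) (pe t θ) (pe t θ) (pe t θ) + fderiv ℝ v (pe t θ) (pe t θ)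
def Vθθ (t θ : ℝ) : ℝ :=
  fderiv ℝ (fderiv ℝ v) (pe t θ) (pj t θ) (pj t θ) - fderiv ℝ v (pe t θ) (pe t θ)


lemma v_hasF (hv : ContDiff ℝ 2 v) (x : EuclideanSpace ℝ (Fin 2)) : HasFDerivAt v (fderiv ℝ v x) x :=
  ((hv.differentiable (by norm_num)) x).hasFDerivAt

lemma v_contDiff1 (hv : ContDiff ℝ 2 v) : ContDiff ℝ 1 (fderiv ℝ v) := hv.fderiv_right (by norm_num)

lemma v_hasF2 (hv : ContDiff ℝ 2 v) (x : EuclideanSpace ℝ (Fin 2)) : HasFDerivAt (fderiv ℝ v) (fderiv ℝ (fderiv ℝ v) x) x :=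
  (((v_contDiff1 v hv).differentiable (by norm_num)) x).hasFDerivAt

lemma v_cont1 (hv : ContDiff ℝ 2 v) : Continuous (fderiv ℝ v) := (v_contDiff1 v hv).continuous

lemma v_cont2 (hv : ContDiff ℝ 2 v) : Continuous (fderiv ℝ (fderiv ℝ v)) :=
  (v_contDiff1 v hv).continuous_fderiv (by norm_num)

lemma V_dt (hv : ContDiff ℝ 2 v) (t θ : ℝ) : HasDerivAt (fun s => v (pe s θ)) (Vt v t θ) t :=
  (v_hasF v hv _).comp_hasDerivAt t (pe_dt t θ)

lemma V_dθ (hv : ContDiff ℝ 2 v) (t θ : ℝ) : HasDerivAt (fun s => v (pe t s)) (Vθ v t θ) θ :=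
  (v_hasF v hv _).comp_hasDerivAt θ (pe_dθ t θ)

lemma Vt_dt (hv : ContDiff ℝ 2 v) (t θ : ℝ) : HasDerivAt (fun s => Vt v s θ) (Vtt v t θ) t :=
  ((v_hasF2 v hv _).comp_hasDerivAt t (pe_dt t θ)).clm_apply (pe_dt t θ)

lemma Vθ_dθ (hv : ContDiff ℝ 2 v) (t θ : ℝ) : HasDerivAt (fun s => Vθ v t s) (Vθθ v t θ) θ := by
  refine (((v_hasF2 v hv _).comp_hasDerivAt θ (pe_dθ t θ)).clm_apply (pj_dθ t θ)).congr_deriv ?_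
  rw [map_neg]
  rfl

lemma V_cont (hv : ContDiff ℝ 2 v) : Continuous fun p : ℝ × ℝ => v (pe p.1 p.2) := hv.continuous.comp pe_cont

lemma Vt_cont (hv : ContDiff ℝ 2 v) : Continuous fun p : ℝ × ℝ => Vt v p.1 p.2 :=
  ((v_cont1 v hv).comp pe_cont).clm_apply pe_cont

lemma Vθ_cont (hv : ContDiff ℝ 2 v) : Continuous fun p : ℝ × ℝ => Vθ v p.1 p.2 :=
  ((v_cont1 v hv).comp pe_cont).clm_apply pj_cont

lemma Vtt_cont (hv : ContDiff ℝ 2 v) : Continuous fun p : ℝ × ℝ => Vtt v p.1 p.2 :=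
  ((((v_cont2 v hv).comp pe_cont).clm_apply pe_cont).clm_apply pe_cont).add (Vt_cont v hv)

lemma Vθθ_cont (hv : ContDiff ℝ 2 v) : Continuous fun p : ℝ × ℝ => Vθθ v p.1 p.2 :=
  ((((v_cont2 v hv).comp pe_cont).clm_apply pj_cont).clm_apply pj_cont).sub (Vt_cont v hv)

lemma planeLaplacian_eq (hv : ContDiff ℝ 2 v) (x : EuclideanSpace ℝ (Fin 2)) : planeLaplacian v x =
    fderiv ℝ (fderiv ℝ v) x (EuclideanSpace.single 0 1) (EuclideanSpace.single 0 1) +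
    fderiv ℝ (fderiv ℝ v) x (EuclideanSpace.single 1 1) (EuclideanSpace.single 1 1) := by
  have key : ∀ e : EuclideanSpace ℝ (Fin 2), deriv (deriv (fun t : ℝ => v (x + t • e))) 0 =
      fderiv ℝ (fderiv ℝ v) x e e := by
    intro e
    have hl : ∀ t : ℝ, HasDerivAt (fun t : ℝ => x + t • e) e t := by
      intro t
      simpa using ((hasDerivAt_id t).smul_const e).const_add x
    have h1 : ∀ t : ℝ, HasDerivAt (fun t : ℝ => v (x + t • e)) (fderiv ℝ v (x + t • e) e) t :=
      fun t => (v_hasF v hv _).comp_hasDerivAt t (hl t)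
    rw [deriv_eq h1]
    have h2 := ((v_hasF2 v hv _).comp_hasDerivAt 0 (hl 0)).clm_apply (hasDerivAt_const (0 : ℝ) e)
    have := h2.deriv
    simpa using this
  unfold planeLaplacian
  rw [Fin.sum_univ_two, key, key]

lemma V_lap (hv : ContDiff ℝ 2 v) (t θ : ℝ) : Vtt v t θ + Vθθ v t θ = Real.exp t ^ 2 * planeLaplacian v (pe t θ) := by
  rw [planeLaplacian_eq v hv]
  unfold Vtt Vθθ
  generalize fderiv ℝ (fderiv ℝ v) (pe t θ) = B
  have : B (pe t θ) (pe t θ) + B (pj t θ) (pj t θ) = Real.exp t ^ 2 *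
      (B (EuclideanSpace.single 0 1) (EuclideanSpace.single 0 1) +
        B (EuclideanSpace.single 1 1) (EuclideanSpace.single 1 1)) := by
    unfold pe pj
    simp only [map_add, map_smul, add_apply, smul_apply, smul_eq_mul]
    linear_combination (Real.exp t ^ 2 *
      (B (EuclideanSpace.single 0 1) (EuclideanSpace.single 0 1) +
        B (EuclideanSpace.single 1 1) (EuclideanSpace.single 1 1))) * Real.sin_sq_add_cos_sq θ
  linarith

lemma V_pde (hv : ContDiff ℝ 2 v) (k : ℕ) (hk : 1 ≤ k) (α : ℝ) (hα : α = 2 * ((k : ℝ) - 1))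
    (heq : ∀ x : EuclideanSpace ℝ (Fin 2),
        planeLaplacian v x
          + 2 * (α + 2) ^ 2 * (‖x‖ ^ α / (1 + ‖x‖ ^ (2 + α)) ^ 2) * v x = 0) (t θ : ℝ) :
    Vtt v t θ + Vθθ v t θ = - (2 * k ^ 2 * (1 - Hh k t ^ 2)) * v (pe t θ) := by
  have h := heq (pe t θ)
  obtain ⟨n1, n2⟩ := norm_pow_alpha k hk α hα ‖pe t θ‖ (norm_nonneg _)
  rw [n1, n2, pe_norm] at h
  rw [V_lap v hv, ← Hh_q]
  have e1 : Real.exp (2 * k * t) = Real.exp t ^ (2 * k) := by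
    rw [← Real.exp_nat_mul]; push_cast; ring_nf
  have e2 : Real.exp t ^ (2 * k) = Real.exp t ^ 2 * Real.exp t ^ (2 * (k - 1)) := by
    rw [← pow_add]; congr 1; omega
  have hα2 : α + 2 = 2 * k := by rw [hα]; ring
  rw [hα2] at h
  rw [eq_neg_of_add_eq_zero_left h, e1]
  nth_rewrite 2 [e2]
  ring

/-- Fourier modes in the angular variable -/
def ch (n : ℤ) (θ : ℝ) : ℂ := Complex.exp (-(n * θ * Complex.I))

lemma ch_norm (n : ℤ) (θ : ℝ) : ‖ch n θ‖ = 1 := by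
  unfold ch
  rw [show -((n : ℂ) * θ * Complex.I) = ((-(n * θ) : ℝ) : ℂ) * Complex.I by push_cast; ring,
    Complex.norm_exp_ofReal_mul_I]

lemma ch_cont (n : ℤ) : Continuous (ch n) := by unfold ch; fun_prop

lemma ch_deriv (n : ℤ) (θ : ℝ) : HasDerivAt (ch n) (-(n * Complex.I) * ch n θ) θ := by
  have h1 : HasDerivAt (fun s : ℝ => -((n : ℂ) * s * Complex.I)) (-(n * Complex.I)) θ := by
    exact (((Complex.ofRealCLM.hasDerivAt (x := θ)).const_mul (n : ℂ)).mul_const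
      Complex.I).neg.congr_deriv (by simp)
  exact (h1.cexp).congr_deriv (by unfold ch; ring)

lemma ch_pi (n : ℤ) : ch n Real.pi = ch n (-Real.pi) := by
  unfold ch
  rw [Complex.exp_eq_exp_iff_exists_int]
  exact ⟨-n, by push_cast; ring⟩

def fm (u : ℝ → ℝ → ℝ) (n : ℤ) (t : ℝ) : ℂ := ∫ θ in (-Real.pi)..Real.pi, (u t θ : ℂ) * ch n θ

lemma fm_deriv (u u1 : ℝ → ℝ → ℝ) (hu : Continuous fun p : ℝ × ℝ => u p.1 p.2)
    (hu1 : Continuous fun p : ℝ × ℝ => u1 p.1 p.2)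
    (h : ∀ t θ, HasDerivAt (fun s => u s θ) (u1 t θ) t) (n : ℤ) (t : ℝ) :
    HasDerivAt (fm u n) (fm u1 n t) t := by
  have hc := ch_cont n
  refine param_deriv _ _ (fun t θ => (u t θ : ℂ) * ch n θ) (fun t θ => (u1 t θ : ℂ) * ch n θ) ?_ ?_ ?_ t
  · unfold Function.uncurry; fun_prop
  · unfold Function.uncurry; fun_prop
  · exact fun t θ => ((h t θ).ofReal_comp).mul_const _

lemma fm_ibp (u u1 : ℝ → ℝ → ℝ) (hu : Continuous fun p : ℝ × ℝ => u p.1 p.2)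
    (hu1 : Continuous fun p : ℝ × ℝ => u1 p.1 p.2)
    (h : ∀ t θ, HasDerivAt (fun s => u t s) (u1 t θ) θ)
    (hper : ∀ t, u t Real.pi = u t (-Real.pi)) (n : ℤ) (t : ℝ) :
    fm u1 n t = n * Complex.I * fm u n t := by
  have hc := ch_cont n
  have c0 : Continuous (fun θ => (u t θ : ℂ)) :=
    Complex.continuous_ofReal.comp (hu.comp (by fun_prop : Continuous fun θ => (t, θ)))
  have c1 : Continuous (fun θ => (u1 t θ : ℂ)) :=
    Complex.continuous_ofReal.comp (hu1.comp (by fun_prop : Continuous fun θ => (t, θ)))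
  have hd : ∀ θ ∈ uIcc (-Real.pi) Real.pi, HasDerivAt (fun θ => (u t θ : ℂ) * ch n θ)
      ((u1 t θ : ℂ) * ch n θ - n * Complex.I * ((u t θ : ℂ) * ch n θ)) θ := by
    intro θ _
    exact (((h t θ).ofReal_comp).mul (ch_deriv n θ)).congr_deriv (by ring)
  have h0 := intervalIntegral.integral_eq_sub_of_hasDerivAt hd
    (Continuous.intervalIntegrable (by fun_prop) _ _)
  rw [intervalIntegral.integral_sub (Continuous.intervalIntegrable (by fun_prop) _ _)
    (Continuous.intervalIntegrable (by fun_prop) _ _), intervalIntegral.integral_const_mul,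
    ch_pi, hper, sub_self] at h0
  exact sub_eq_zero.1 h0

lemma fm_bound (u : ℝ → ℝ → ℝ) (w : ℝ → ℝ)
    (hw : Continuous w) (t : ℝ)
    (hb : ∀ θ, |u t θ| ≤ w θ) (n : ℤ) : ‖fm u n t‖ ≤ ∫ θ in (-Real.pi)..Real.pi, w θ := by
  refine intervalIntegral.norm_integral_le_of_norm_le (by linarith [Real.pi_pos])
    (Filter.Eventually.of_forall fun θ _ => ?_) (hw.intervalIntegrable _ _)
  rw [norm_mul, ch_norm, mul_one, Complex.norm_real]
  exact hb θ

end pde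

lemma energy_lower (S : EuclideanSpace ℝ (Fin 2) → ℝ) (hS : Continuous S) (hS0 : ∀ x, 0 ≤ S x)
    (hint : Integrable S) (c : ℝ) (hc : 0 < c)
    (h : ∀ t, 0 ≤ t → c ≤ ∫ θ in (-Real.pi)..Real.pi, S (pe t θ)) : False := by
  have h1 : ∫⁻ x, ENNReal.ofReal (S x) < ⊤ := hint.lintegral_lt_top
  have hmS : Measurable (fun x => ENNReal.ofReal (S x)) := hS.measurable.ennreal_ofReal
  have h2 := (Complex.orthonormalBasisOneI.measurePreserving_repr).lintegral_comp hmS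
  rw [← h2, ← Complex.lintegral_comp_polarCoord_symm, polarCoord_target] at h1
  let P : ℝ × ℝ → EuclideanSpace ℝ (Fin 2) := fun p =>
    (p.1 * Real.cos p.2) • EuclideanSpace.single 0 (1 : ℝ)
    + (p.1 * Real.sin p.2) • EuclideanSpace.single 1 (1 : ℝ)
  have hP : Continuous P := by fun_prop
  have h3 : ∀ p : ℝ × ℝ, Complex.orthonormalBasisOneI.repr (Complex.polarCoord.symm p) = P p := by
    intro p
    ext i
    rw [Complex.orthonormalBasisOneI_repr_apply]
    fin_cases i <;> simp [P, Complex.polarCoord_symm_apply]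
    · left; rw [← Complex.ofReal_cos, Complex.ofReal_re]
    · left; rw [← Complex.ofReal_sin, Complex.ofReal_re]
  simp only [h3, smul_eq_mul] at h1
  have hm : Measurable fun p : ℝ × ℝ => ENNReal.ofReal p.1 * ENNReal.ofReal (S (P p)) :=
    (measurable_fst.ennreal_ofReal).mul (hS.comp hP).measurable.ennreal_ofReal
  rw [Measure.volume_eq_prod, setLIntegral_prod _ hm.aemeasurable] at h1
  refine absurd h1 (not_lt.2 ?_)
  calc (⊤ : ENNReal) = ∫⁻ r in Ioi (1 : ℝ), ENNReal.ofReal c := by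
        rw [setLIntegral_const, Real.volume_Ioi, ENNReal.mul_top (by simpa using hc)]
    _ ≤ ∫⁻ r in Ioi (1 : ℝ), ∫⁻ θ in Ioo (-Real.pi) Real.pi,
          ENNReal.ofReal r * ENNReal.ofReal (S (P (r, θ))) := by
        refine setLIntegral_mono' measurableSet_Ioi fun r hr => ?_
        have hr1 : (1 : ℝ) < r := hr
        have hpe : ∀ θ, P (r, θ) = pe (Real.log r) θ := by
          intro θ; simp only [P, pe]; rw [Real.exp_log (by linarith)]
        have hcont : Continuous fun θ => S (P (r, θ)) := hS.comp (hP.comp (by fun_prop))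
        have h4 := h (Real.log r) (Real.log_nonneg hr1.le)
        simp only [← hpe] at h4
        rw [intervalIntegral.integral_of_le (by linarith [Real.pi_pos]),
          integral_Ioc_eq_integral_Ioo] at h4
        calc ENNReal.ofReal c ≤ _ := ENNReal.ofReal_le_ofReal h4
          _ = ∫⁻ θ in Ioo (-Real.pi) Real.pi, ENNReal.ofReal (S (P (r, θ))) :=
            ofReal_integral_eq_lintegral_ofReal
              ((hcont.integrableOn_Icc).mono_set Ioo_subset_Icc_self)
              (Filter.Eventually.of_forall fun θ => hS0 _)
          _ ≤ _ := by
            refine lintegral_mono fun θ => ?_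
            have : (1 : ENNReal) ≤ ENNReal.ofReal r := by simpa using hr1.le
            calc _ = 1 * ENNReal.ofReal (S (P (r, θ))) := (one_mul _).symm
              _ ≤ _ := by gcongr
    _ ≤ _ := lintegral_mono_set (Ioi_subset_Ioi zero_le_one)

lemma fm_comb (P Q R : ℝ → ℝ → ℝ) (κ : ℝ) (n : ℤ) (t : ℝ) (hQ : Continuous fun θ => Q t θ)
    (hR : Continuous fun θ => R t θ) (h : ∀ θ, P t θ = κ * Q t θ - R t θ) :
    fm P n t = (κ : ℂ) * fm Q n t - fm R n t := by
  have hc := ch_cont n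
  have c0 : Continuous (fun θ => (Q t θ : ℂ) * ch n θ) :=
    (Complex.continuous_ofReal.comp hQ).mul hc
  have c2 : Continuous (fun θ => (R t θ : ℂ) * ch n θ) :=
    (Complex.continuous_ofReal.comp hR).mul hc
  have c1 : Continuous (fun θ => (κ : ℂ) * ((Q t θ : ℂ) * ch n θ)) := continuous_const.mul c0
  unfold fm
  rw [← intervalIntegral.integral_const_mul, ← intervalIntegral.integral_sub
    (c1.intervalIntegrable _ _) (c2.intervalIntegrable _ _)]
  congr 1
  funext θ
  rw [h]
  push_cast
  ring

set_option maxHeartbeats 1000000 in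
lemma modes (v : EuclideanSpace ℝ (Fin 2) → ℝ) (hv : ContDiff ℝ 2 v)
    (k : ℕ) (hk : 1 ≤ k) (α : ℝ) (hα : α = 2 * ((k : ℝ) - 1))
    (heq : ∀ x : EuclideanSpace ℝ (Fin 2),
        planeLaplacian v x
          + 2 * (α + 2) ^ 2 * (‖x‖ ^ α / (1 + ‖x‖ ^ (2 + α)) ^ 2) * v x = 0)
    (hint : Integrable (fun x : EuclideanSpace ℝ (Fin 2) => ‖fderiv ℝ v x‖ ^ 2)) (n : ℤ) :
    (n = 0 → ∃ A : ℂ, ∀ t, fm (fun t θ => v (pe t θ)) n t = A * Hh k t) ∧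
    (n ≠ 0 → (∀ t, fm (fun t θ => v (pe t θ)) n t = 2 * fm (fun t θ => v (pe t θ)) n 0 *
        ((Real.exp (k * t) / (1 + Real.exp (2 * k * t)) : ℝ) : ℂ)) ∧
      ((n : ℝ) ^ 2 ≠ k ^ 2 → ∀ t, fm (fun t θ => v (pe t θ)) n t = 0)) := by
  set f := fm (fun t θ => v (pe t θ)) n with hfd
  set f1 := fm (Vt v) n with hf1d
  have hf : ∀ t, HasDerivAt f (f1 t) t :=
    fm_deriv _ _ (V_cont v hv) (Vt_cont v hv) (V_dt v hv) n
  have hθ : ∀ t, fm (Vθ v) n t = n * Complex.I * f t :=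
    fm_ibp _ _ (V_cont v hv) (Vθ_cont v hv) (V_dθ v hv)
      (fun t => by rw [← pe_periodic t (-Real.pi)]; congr 2; ring) n
  have hθθ : ∀ t, fm (Vθθ v) n t = n * Complex.I * fm (Vθ v) n t :=
    fm_ibp _ _ (Vθ_cont v hv) (Vθθ_cont v hv) (Vθ_dθ v hv)
      (fun t => by
        unfold Vθ; rw [← pe_periodic t (-Real.pi), ← pj_periodic t (-Real.pi),
          show -Real.pi + 2 * Real.pi = Real.pi by ring]) n
  have hf1 : ∀ t, HasDerivAt f1
      (((((n : ℝ) ^ 2) - 2 * k ^ 2 * (1 - Hh k t ^ 2) : ℝ) : ℂ) * f t) t := by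
    intro t
    refine (fm_deriv _ _ (Vt_cont v hv) (Vtt_cont v hv) (Vt_dt v hv) n t).congr_deriv ?_
    have hl : Continuous fun θ : ℝ => (t, θ) := by fun_prop
    have e : fm (Vtt v) n t = ((-(2 * k ^ 2 * (1 - Hh k t ^ 2)) : ℝ) : ℂ) * f t
        - fm (Vθθ v) n t := by
      refine fm_comb (Vtt v) (fun t θ => v (pe t θ)) (Vθθ v) _ n t ((V_cont v hv).comp hl)
        ((Vθθ_cont v hv).comp hl) fun θ => ?_
      have := V_pde v hv k hk α hα heq t θ
      linarith
    rw [e, hθθ, hθ]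
    push_cast
    linear_combination (- (n : ℂ) ^ 2 * f t) * Complex.I_mul_I
  -- bounds near -∞
  obtain ⟨C0, hC0⟩ := (isCompact_closedBall (0 : EuclideanSpace ℝ (Fin 2)) 1).exists_bound_of_continuousOn
    hv.continuous.continuousOn
  obtain ⟨C1, hC1⟩ := (isCompact_closedBall (0 : EuclideanSpace ℝ (Fin 2)) 1).exists_bound_of_continuousOn
    (v_cont1 v hv).continuousOn
  have hmem : ∀ t ≤ 0, ∀ θ, pe t θ ∈ Metric.closedBall (0 : EuclideanSpace ℝ (Fin 2)) 1 := by
    intro t ht θ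
    rw [mem_closedBall_zero_iff, pe_norm]
    exact Real.exp_le_one_iff.2 ht
  have hVt : ∀ t θ, |Vt v t θ| ≤ Real.exp t * ‖fderiv ℝ v (pe t θ)‖ := by
    intro t θ
    have := (fderiv ℝ v (pe t θ)).le_opNorm (pe t θ)
    rw [pe_norm] at this
    unfold Vt
    rw [← Real.norm_eq_abs]; linarith
  have hVθ : ∀ t θ, |Vθ v t θ| ≤ Real.exp t * ‖fderiv ℝ v (pe t θ)‖ := by
    intro t θ
    have := (fderiv ℝ v (pe t θ)).le_opNorm (pj t θ)
    rw [pj_norm] at this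
    unfold Vθ
    rw [← Real.norm_eq_abs]; linarith
  have hC1n : 0 ≤ C1 := (norm_nonneg _).trans (hC1 _ (hmem 0 le_rfl 0))
  have bf : ∃ M, ∀ t ≤ 0, ‖f t‖ ≤ M := ⟨_, fun t ht => fm_bound _ (fun _ => C0) continuous_const t
    (fun θ => hC0 _ (hmem t ht θ)) n⟩
  have bf1 : ∃ M, ∀ t ≤ 0, ‖f1 t‖ ≤ M := ⟨_, fun t ht => fm_bound _ (fun _ => C1) continuous_const t
    (fun θ => (hVt t θ).trans (by
      have := hC1 _ (hmem t ht θ)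
      have h2 := Real.exp_le_one_iff.2 ht
      calc _ ≤ 1 * C1 := by gcongr
        _ = C1 := one_mul _)) n⟩
  obtain ⟨M0, hM0⟩ := bf
  obtain ⟨M1, hM1⟩ := bf1
  have hkH : ∀ t, ‖((k * Hh k t : ℝ) : ℂ)‖ ≤ k := by
    intro t
    rw [Complex.norm_real, norm_mul, Real.norm_natCast, Real.norm_eq_abs]
    have := Hh_abs k t
    calc (k : ℝ) * |Hh k t| ≤ k * 1 := by gcongr
      _ = k := mul_one _
  have ggb : ∀ t, ‖gg k f f1 t‖ ≤ ‖f1 t‖ + k * ‖f t‖ := by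
    intro t
    unfold gg
    refine (norm_sub_le _ _).trans ?_
    rw [norm_mul]
    have := hkH t
    gcongr
  have hM0n : 0 ≤ M0 := (norm_nonneg _).trans (hM0 0 le_rfl)
  have bg : ∀ t ≤ 0, ‖gg k f f1 t‖ ≤ M1 + k * M0 := fun t ht => (ggb t).trans (by
    have := hM0 t ht
    have := hM1 t ht
    gcongr)
  have bg1 : ∀ t ≤ 0, ‖gg1 k ((n : ℝ) ^ 2) f f1 t‖ ≤
      ‖(((n : ℝ) ^ 2 - k ^ 2 : ℝ) : ℂ)‖ * M0 + k * (M1 + k * M0) := by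
    intro t ht
    unfold gg1
    refine (norm_sub_le _ _).trans ?_
    rw [norm_mul, norm_mul]
    have := hM0 t ht
    have := bg t ht
    have := hkH t
    gcongr
  have dg := gg_deriv k ((n : ℝ) ^ 2) f f1 hf hf1
  have dg1 := gg1_deriv k ((n : ℝ) ^ 2) f f1 hf hf1
  have hk0 : (k : ℂ) ≠ 0 := by exact_mod_cast (by omega : k ≠ 0)
  constructor
  · intro hn
    have hz := zero_mode _ _ _ dg (fun t => (dg1 t).congr_deriv (by simp [hn])) bg
    refine ⟨-(gg k f f1 0 / k), fun t => ?_⟩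
    have h1 := (hz t).1
    unfold gg1 at h1
    rw [(hz t).2, hn] at h1
    push_cast at h1
    have : (k : ℂ) * (k * f t + Hh k t * gg k f f1 0) = 0 := by linear_combination -h1
    have h3 := (mul_eq_zero.1 this).resolve_left hk0
    field_simp
    linear_combination h3
  · intro hn
    have hn1 : (1 : ℝ) ≤ |(n : ℝ)| := by exact_mod_cast Int.one_le_abs hn
    have hm : 0 < |(n : ℝ)| := by linarith
    have hgr := growth |(n : ℝ)| (max (M1 + k * M0)
      (‖(((n : ℝ) ^ 2 - k ^ 2 : ℝ) : ℂ)‖ * M0 + k * (M1 + k * M0))) hm _ _ dg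
      (fun t => (dg1 t).congr_deriv (by rw [sq_abs])) (fun t ht => (bg t ht).trans (le_max_left _ _))
      (fun t ht => (bg1 t ht).trans (le_max_right _ _))
    have hg0 : gg k f f1 0 = 0 := by
      by_contra hne
      have hpos : 0 < ‖gg k f f1 0‖ := norm_pos_iff.2 hne
      set c := ‖gg k f f1 0‖ / (1 + k) with hcd
      have hc : 0 < c := by positivity
      have hcD : ∀ t, Continuous fun θ => ‖fderiv ℝ v (pe t θ)‖ := fun t =>
        ((v_cont1 v hv).comp (pe_cont.comp (by fun_prop : Continuous fun θ : ℝ => (t, θ)))).norm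
      have hlow : ∀ t, 0 ≤ t → c ≤ ∫ θ in (-Real.pi)..Real.pi, ‖fderiv ℝ v (pe t θ)‖ := by
        intro t ht
        set I := ∫ θ in (-Real.pi)..Real.pi, ‖fderiv ℝ v (pe t θ)‖ with hI
        have b1 : ‖f1 t‖ ≤ Real.exp t * I := by
          rw [hI, ← intervalIntegral.integral_const_mul]
          exact fm_bound _ _ (continuous_const.mul (hcD t)) t (hVt t) n
        have b2 : ‖fm (Vθ v) n t‖ ≤ Real.exp t * I := by
          rw [hI, ← intervalIntegral.integral_const_mul]
          exact fm_bound _ _ (continuous_const.mul (hcD t)) t (hVθ t) n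
        have b3 : ‖f t‖ ≤ Real.exp t * I := by
          refine le_trans ?_ b2
          rw [hθ, norm_mul, norm_mul, Complex.norm_I, mul_one, Complex.norm_intCast]
          exact le_mul_of_one_le_left (norm_nonneg _) hn1
        have b4 : ‖gg k f f1 t‖ ≤ (1 + k) * (Real.exp t * I) := by
          have := mul_le_mul_of_nonneg_left b3 (Nat.cast_nonneg (α := ℝ) k)
          have := ggb t
          linarith
        rw [hgr t, norm_mul, Complex.norm_real, Real.norm_of_nonneg (Real.exp_pos _).le] at b4
        have b5 : Real.exp t ≤ Real.exp (|(n : ℝ)| * t) :=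
          Real.exp_le_exp.2 (le_mul_of_one_le_left ht hn1)
        have b6 := mul_le_mul_of_nonneg_left b5 hpos.le
        have b7 : ‖gg k f f1 0‖ * Real.exp t ≤ ((1 + k) * I) * Real.exp t := by linarith
        have b8 := le_of_mul_le_mul_right b7 (Real.exp_pos t)
        rw [hcd, div_le_iff₀ (by positivity)]
        linarith
      refine energy_lower (fun x => ‖fderiv ℝ v x‖ ^ 2) ((v_cont1 v hv).norm.pow 2)
        (fun x => by positivity) hint (c ^ 2 / (2 * Real.pi)) (by positivity) (fun t ht => ?_)
      have hpi := Real.pi_pos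
      set δ := c / (2 * Real.pi) with hδ
      have hle : ∫ θ in (-Real.pi)..Real.pi, (2 * δ * ‖fderiv ℝ v (pe t θ)‖ - δ ^ 2) ≤
          ∫ θ in (-Real.pi)..Real.pi, ‖fderiv ℝ v (pe t θ)‖ ^ 2 := by
        refine intervalIntegral.integral_mono_on (by linarith)
          (((continuous_const.mul (hcD t)).sub continuous_const).intervalIntegrable _ _)
          (((hcD t).pow 2).intervalIntegrable _ _) fun θ _ => ?_
        nlinarith [sq_nonneg (‖fderiv ℝ v (pe t θ)‖ - δ)]
      have c1 : Continuous fun θ => 2 * δ * ‖fderiv ℝ v (pe t θ)‖ := continuous_const.mul (hcD t)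
      rw [intervalIntegral.integral_sub (c1.intervalIntegrable _ _)
        intervalIntegrable_const, intervalIntegral.integral_const_mul,
        intervalIntegral.integral_const, smul_eq_mul] at hle
      refine le_trans ?_ hle
      have h9 := mul_le_mul_of_nonneg_left (hlow t ht) (show 0 ≤ 2 * δ by positivity)
      have h10 : c ^ 2 / (2 * Real.pi) = 2 * δ * c - (Real.pi - -Real.pi) * δ ^ 2 := by
        rw [hδ]; field_simp; ring
      linarith
    have hg : ∀ t, gg k f f1 t = 0 := fun t => by rw [hgr t, hg0, zero_mul]
    refine ⟨sech_mode k f f1 hf hg, fun hnk t => ?_⟩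
    have hg1 : gg1 k ((n : ℝ) ^ 2) f f1 t = 0 :=
      (dg t).unique ((hasDerivAt_const t (0 : ℂ)).congr_of_eventuallyEq
        (Filter.Eventually.of_forall hg))
    unfold gg1 at hg1
    rw [hg t, mul_zero, sub_zero] at hg1
    refine (mul_eq_zero.1 hg1).resolve_left ?_
    exact_mod_cast sub_ne_zero.2 hnk

lemma fourier_rec (F : ℝ → ℂ) (hF : Continuous F) (hper : Function.Periodic F (2 * Real.pi))
    (k : ℕ) (hk : 1 ≤ k)
    (h0 : ∀ n : ℤ, n ≠ 0 → n ≠ k → n ≠ -k → ∫ θ in (-Real.pi)..Real.pi, F θ * ch n θ = 0) (θ : ℝ) :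
    F θ = (1 / (2 * Real.pi) : ℝ) * ((∫ θ in (-Real.pi)..Real.pi, F θ * ch 0 θ)
      + (∫ θ in (-Real.pi)..Real.pi, F θ * ch k θ) * Complex.exp (k * θ * Complex.I)
      + (∫ θ in (-Real.pi)..Real.pi, F θ * ch (-k) θ) * Complex.exp (-(k * θ * Complex.I))) := by
  have : Fact (0 < 2 * Real.pi) := ⟨by positivity⟩
  let G : C(AddCircle (2 * Real.pi), ℂ) := ⟨hper.lift, hF.quotient_lift _⟩
  have hpi : (Real.pi : ℂ) ≠ 0 := by exact_mod_cast Real.pi_ne_zero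
  have hG : ∀ x : ℝ, G (x : AddCircle (2 * Real.pi)) = F x := fun x => rfl
  have hfou : ∀ (n : ℤ) (x : ℝ), fourier n (x : AddCircle (2 * Real.pi)) =
      Complex.exp (n * x * Complex.I) := by
    intro n x
    rw [fourier_coe_apply]
    congr 1
    push_cast
    field_simp
  have hco : ∀ n, fourierCoeff G n = (1 / (2 * Real.pi) : ℝ) * ∫ θ in (-Real.pi)..Real.pi, F θ * ch n θ := by
    intro n
    rw [fourierCoeff_eq_intervalIntegral G n (-Real.pi), Complex.real_smul,
      show -Real.pi + 2 * Real.pi = Real.pi by ring]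
    congr 2
    funext x
    rw [hG, hfou, smul_eq_mul, mul_comm]
    unfold ch
    congr 2
    push_cast
    ring
  have hsupp : ∀ n ∉ ({0, (k : ℤ), -(k : ℤ)} : Finset ℤ), fourierCoeff G n = 0 := by
    intro n hn
    simp only [Finset.mem_insert, Finset.mem_singleton, not_or] at hn
    rw [hco, h0 n hn.1 hn.2.1 hn.2.2, mul_zero]
  have hsum : Summable (fourierCoeff G) := summable_of_ne_finset_zero hsupp
  have hs := has_pointwise_sum_fourier_series_of_summable hsum (θ : AddCircle (2 * Real.pi))
  have hs2 := hasSum_sum_of_ne_finset_zero (L := .unconditional ℤ) (f := fun i => fourierCoeff G i •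
    fourier i (θ : AddCircle (2 * Real.pi))) (s := {0, (k : ℤ), -(k : ℤ)})
    (fun n hn => by rw [hsupp n hn, zero_smul])
  have := hs.unique hs2
  rw [hG, Finset.sum_insert (by simp; omega), Finset.sum_insert (by simp; omega),
    Finset.sum_singleton] at this
  rw [this, hco, hco, hco, hfou, hfou, hfou]
  simp only [smul_eq_mul]
  push_cast
  simp only [zero_mul, Complex.exp_zero, neg_mul]
  ring

theorem forward (k : ℕ) (hk : 1 ≤ k) (α : ℝ) (hα : α = 2 * ((k : ℝ) - 1))
    (v : EuclideanSpace ℝ (Fin 2) → ℝ) (hv : ContDiff ℝ 2 v)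
    (heq : ∀ x : EuclideanSpace ℝ (Fin 2),
        planeLaplacian v x
          + 2 * (α + 2) ^ 2 * (‖x‖ ^ α / (1 + ‖x‖ ^ (2 + α)) ^ 2) * v x = 0)
    (hint : Integrable (fun x : EuclideanSpace ℝ (Fin 2) => ‖fderiv ℝ v x‖ ^ 2)) :
    ∃ c₀ c₁ c₂ : ℝ, ∀ x : EuclideanSpace ℝ (Fin 2), v x = linSol α k c₀ c₁ c₂ x := by
  have hm := modes v hv k hk α hα heq hint
  obtain ⟨A, hA⟩ := (hm 0).1 rfl
  have hB := ((hm k).2 (by omega)).1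
  have hC := ((hm (-k)).2 (by omega)).1
  set B := 2 * fm (fun t θ => v (pe t θ)) k 0
  set C := 2 * fm (fun t θ => v (pe t θ)) (-k) 0
  set s : ℝ := 1 / (2 * Real.pi) with hs
  refine ⟨s * A.re, s * (B.re + C.re), s * (C.im - B.im), ?_⟩
  have hpe : ∀ t θ, v (pe t θ) = linSol α k (s * A.re) (s * (B.re + C.re)) (s * (C.im - B.im)) (pe t θ) := by
    intro t θ
    have hrec := fourier_rec (fun θ => (v (pe t θ) : ℂ))
      (Complex.continuous_ofReal.comp ((V_cont v hv).comp (by fun_prop : Continuous fun θ : ℝ => (t, θ))))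
      (fun θ => by simp only [pe_periodic]) k hk
      (fun n h1 h2 h3 => ((hm n).2 h1).2 (by
        intro h
        have h' : n ^ 2 = (k : ℤ) ^ 2 := by exact_mod_cast h
        rcases sq_eq_sq_iff_eq_or_eq_neg.1 h' with h' | h'
        · exact h2 h'
        · exact h3 h') t) θ
    have hA' := hA t
    have hB' := hB t
    have hC' := hC t
    unfold fm at hA' hB' hC'
    rw [hA', hB', hC'] at hrec
    have hre := congrArg Complex.re hrec
    rw [Complex.ofReal_re] at hre
    rw [hre, linSol_eq k hk α hα, zc_pe]
    have hz : ((Real.exp t : ℂ) * Complex.exp (θ * Complex.I)) ^ k =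
        ((Real.exp (k * t) : ℝ) : ℂ) * Complex.exp (((k * θ : ℝ) : ℂ) * Complex.I) := by
      rw [mul_pow, ← Complex.exp_nat_mul, Real.exp_nat_mul]
      push_cast
      ring_nf
    have e1 : Complex.exp (k * θ * Complex.I) = Complex.exp (((k * θ : ℝ) : ℂ) * Complex.I) := by
      push_cast; rfl
    have e2 : Complex.exp (-(k * θ * Complex.I)) = Complex.exp (((-(k * θ) : ℝ) : ℂ) * Complex.I) := by
      push_cast; ring_nf
    have e3 : Real.exp (2 * k * t) = Real.exp (k * t) ^ 2 := by
      rw [← Real.exp_nat_mul]; push_cast; ring_nf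
    rw [hz, e1, e2]
    unfold Fm Hh
    rw [e3]
    simp only [Complex.add_re, Complex.mul_re, Complex.mul_im, Complex.ofReal_re, Complex.ofReal_im,
      Complex.exp_ofReal_mul_I_re, Complex.exp_ofReal_mul_I_im, Real.cos_neg, Real.sin_neg]
    generalize Real.exp (k * t) = y
    have hcs := Real.sin_sq_add_cos_sq (k * θ)
    have hden : 1 + ((y * Real.cos (k * θ) - 0 * Real.sin (k * θ)) ^ 2 +
        (y * Real.sin (k * θ) + 0 * Real.cos (k * θ)) ^ 2) = 1 + y ^ 2 := by
      linear_combination y ^ 2 * hcs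
    have hden2 : 1 - ((y * Real.cos (k * θ) - 0 * Real.sin (k * θ)) ^ 2 +
        (y * Real.sin (k * θ) + 0 * Real.cos (k * θ)) ^ 2) = 1 - y ^ 2 := by
      linear_combination - y ^ 2 * hcs
    rw [hden, hden2]
    rw [← hs]
    have hpos : 1 + y ^ 2 ≠ 0 := by positivity
    field_simp
    ring
  have hfun : v = linSol α k (s * A.re) (s * (B.re + C.re)) (s * (C.im - B.im)) := by
    refine Continuous.ext_on (dense_compl_singleton (0 : EuclideanSpace ℝ (Fin 2))) hv.continuous
      (linSol_contDiff k hk α hα _ _ _).continuous fun x hx => ?_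
    obtain ⟨t, θ, rfl⟩ := exists_pe x hx
    exact hpe t θ
  exact fun x => congrFun hfun x

/-- for `α = 2(k−1)`, `k ≥ 1` an integer, the space of
finite-Dirichlet-energy solutions of the linearized equation
`Δv + 2(α+2)² |x|^α/(1+|x|^{2+α})² v = 0` in `ℝ²` is exactly the three-dimensional
family `linSol α k c₀ c₁ c₂`. -/
theorem stmt_16 (k : ℕ) (hk : 1 ≤ k) (α : ℝ) (hα : α = 2 * ((k : ℝ) - 1)) :
    (∀ v : EuclideanSpace ℝ (Fin 2) → ℝ, ContDiff ℝ 2 v →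
      (∀ x : EuclideanSpace ℝ (Fin 2),
        planeLaplacian v x
          + 2 * (α + 2) ^ 2 * (‖x‖ ^ α / (1 + ‖x‖ ^ (2 + α)) ^ 2) * v x = 0) →
      Integrable (fun x : EuclideanSpace ℝ (Fin 2) => ‖fderiv ℝ v x‖ ^ 2) →
      ∃ c₀ c₁ c₂ : ℝ, ∀ x : EuclideanSpace ℝ (Fin 2), v x = linSol α k c₀ c₁ c₂ x) ∧
    (∀ c₀ c₁ c₂ : ℝ,
      ContDiff ℝ 2 (linSol α k c₀ c₁ c₂) ∧
      (∀ x : EuclideanSpace ℝ (Fin 2),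
        planeLaplacian (linSol α k c₀ c₁ c₂) x
          + 2 * (α + 2) ^ 2 * (‖x‖ ^ α / (1 + ‖x‖ ^ (2 + α)) ^ 2) *
            linSol α k c₀ c₁ c₂ x = 0) ∧
      Integrable (fun x : EuclideanSpace ℝ (Fin 2) =>
        ‖fderiv ℝ (linSol α k c₀ c₁ c₂) x‖ ^ 2)) := by
  exact ⟨fun v hv heq hint => forward k hk α hα v hv heq hint,
    fun c₀ c₁ c₂ => ⟨linSol_contDiff k hk α hα c₀ c₁ c₂, linSol_pde k hk α hα c₀ c₁ c₂,
      linSol_energy k hk α hα c₀ c₁ c₂⟩⟩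

end
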